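/- Let b: [0,∞) → (0,∞) be measurable, locally bounded, and regularly varying at infinity with exponent β > 0. Then there exists a function f̃: [0,∞) → [0,∞) that is nondecreasing and concave on [0,∞), satisfies f̃(0) = 0 and lim_{x→∞} f̃(x) = ∞, and is asymptotically equivalent to b∘log, i.e. lim_{x→∞} f̃(x)/b(log x) = 1. -/

import Mathlib

open MeasureTheory Filter Set

/-- If `k (t + u) - k t → 0` for every `u`, then the convergence holds in measure for `u` in a
compact interval. -/
lemma eventually_volume_bad_lt {k : ℝ → ℝ} (hk : Measurable k)
    (h : ∀ u, Tendsto (fun t => k (t + u) - k t) atTop (nhds 0)) (a : ℝ) {ε : ℝ} (hε : 0 < ε) :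
    ∀ᶠ t in atTop,
      volume ({v | ε ≤ |k (t + v) - k t|} ∩ Icc 0 a) < ENNReal.ofReal (1 / 2) := by
  have hlim : Tendsto (fun t => volume ({v | ε ≤ |k (t + v) - k t|} ∩ Icc 0 a)) atTop
      (nhds 0) := by
    refine tendsto_of_seq_tendsto fun s hs => ?_
    have hm : TendstoInMeasure (volume.restrict (Icc (0 : ℝ) a))
        (fun n v => k (s n + v) - k (s n)) atTop (fun _ => (0 : ℝ)) := by
      refine tendstoInMeasure_of_tendsto_ae (fun n => ?_)
        (Eventually.of_forall fun v => (h v).comp hs)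
      exact ((hk.comp (measurable_const_add (s n))).sub_const _).aestronglyMeasurable
    have hm' := tendstoInMeasure_iff_norm.1 hm ε hε
    simpa [Measure.restrict_apply' measurableSet_Icc, Function.comp_def] using hm'
  exact hlim.eventually (gt_mem_nhds (by simp))

/-- Uniform convergence theorem for additively slowly varying measurable functions. -/
lemma exists_forall_abs_shift_sub_le {k : ℝ → ℝ} (hk : Measurable k)
    (h : ∀ u, Tendsto (fun t => k (t + u) - k t) atTop (nhds 0)) {ε : ℝ} (hε : 0 < ε) :
    ∃ T, ∀ t ≥ T, ∀ u ∈ Icc (0 : ℝ) 1, |k (t + u) - k t| ≤ ε := by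
  obtain ⟨T, hT⟩ := eventually_atTop.1 (eventually_volume_bad_lt hk h 2 (half_pos hε))
  refine ⟨T, fun t ht u hu => ?_⟩
  have h1 := hT t ht
  have h2 := hT (t + u) (by linarith [hu.1])
  set A := {v | ε / 2 ≤ |k (t + v) - k t|} ∩ Icc 0 2
  set B := {v | ε / 2 ≤ |k (t + u + v) - k (t + u)|} ∩ Icc 0 2
  have h3 : volume ((fun v => v - u) ⁻¹' B) < ENNReal.ofReal (1 / 2) := by
    simpa only [sub_eq_add_neg, measure_preimage_add_right] using h2
  have hnot : ¬ Icc (1 : ℝ) 2 ⊆ A ∪ (fun v => v - u) ⁻¹' B := by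
    intro hsub
    have hlt := (measure_mono (μ := volume) hsub).trans_lt
      ((measure_union_le _ _).trans_lt (ENNReal.add_lt_add h1 h3))
    rw [Real.volume_Icc, ← ENNReal.ofReal_add (by norm_num) (by norm_num)] at hlt
    norm_num at hlt
  obtain ⟨v, hv, hvn⟩ := not_subset.1 hnot
  have hvA : |k (t + v) - k t| < ε / 2 := by
    by_contra! hc
    exact hvn (Or.inl ⟨hc, by linarith [hv.1], hv.2⟩)
  have hvB : |k (t + v) - k (t + u)| < ε / 2 := by
    by_contra! hc
    refine hvn (Or.inr ⟨?_, ?_, ?_⟩)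
    · simpa [add_assoc] using hc
    · linarith [hv.1, hu.2]
    · linarith [hv.2, hu.1]
  rw [abs_lt] at hvA hvB
  exact abs_le.2 ⟨by linarith [hvA.1, hvB.2], by linarith [hvA.2, hvB.1]⟩

lemma exists_forall_abs_shift_sub_le_linear {k : ℝ → ℝ} (hk : Measurable k)
    (h : ∀ u, Tendsto (fun t => k (t + u) - k t) atTop (nhds 0)) {ε : ℝ} (hε : 0 < ε) :
    ∃ T, ∀ t ≥ T, ∀ u ≥ 0, |k (t + u) - k t| ≤ ε * (1 + u) := by
  obtain ⟨T, hT⟩ := exists_forall_abs_shift_sub_le hk h hε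
  refine ⟨T, fun t ht u hu => ?_⟩
  have hn : ∀ n : ℕ, |k (t + n) - k t| ≤ ε * n := by
    intro n
    induction n with
    | zero => simp
    | succ n ih =>
      have hstep := hT (t + n) (by linarith [n.cast_nonneg (α := ℝ)]) 1 ⟨by norm_num, le_rfl⟩
      have htri := abs_sub_le (k (t + n + 1)) (k (t + n)) (k t)
      push_cast
      rw [← add_assoc]
      linarith
  have hfl := Nat.floor_le hu
  have hlast := hT (t + ⌊u⌋₊) (by linarith [(⌊u⌋₊).cast_nonneg (α := ℝ)]) (u - ⌊u⌋₊)
    ⟨by linarith, by linarith [Nat.lt_floor_add_one u]⟩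
  rw [show t + (⌊u⌋₊ : ℝ) + (u - ⌊u⌋₊) = t + u by ring] at hlast
  have htri := abs_sub_le (k (t + u)) (k (t + ⌊u⌋₊)) (k t)
  nlinarith [hn ⌊u⌋₊]

/-- Potter bounds for regularly varying functions, in logarithmic form. -/
lemma potter_bound {b : ℝ → ℝ} (hb_meas : Measurable b) (hb_pos : ∀ y ≥ (0:ℝ), 0 < b y) {β : ℝ}
    (hb_rv : ∀ l > (0:ℝ), Tendsto (fun y : ℝ => b (l * y) / b y) atTop (nhds (l ^ β)))
    {ε : ℝ} (hε : 0 < ε) :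
    ∃ X > 0, ∀ x ≥ X, ∀ y ≥ x,
      |Real.log (b y) - Real.log (b x) - β * (Real.log y - Real.log x)|
        ≤ ε * (1 + (Real.log y - Real.log x)) := by
  have hk : Measurable fun t => Real.log (b (Real.exp t)) - β * t := by fun_prop
  have hshift : ∀ u, Tendsto (fun t => (Real.log (b (Real.exp (t + u))) - β * (t + u)) -
      (Real.log (b (Real.exp t)) - β * t)) atTop (nhds 0) := by
    intro u
    have hlog := ((hb_rv (Real.exp u) (Real.exp_pos u)).log
      (Real.rpow_pos_of_pos (Real.exp_pos u) β).ne').comp Real.tendsto_exp_atTop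
    rw [Real.log_rpow (Real.exp_pos u), Real.log_exp] at hlog
    have hsub := hlog.sub_const (β * u)
    rw [sub_self] at hsub
    refine hsub.congr fun t => ?_
    simp only [Function.comp_apply]
    rw [Real.log_div (hb_pos _ (by positivity)).ne' (hb_pos _ (by positivity)).ne',
      ← Real.exp_add, add_comm u t]
    ring
  obtain ⟨T, hT⟩ := exists_forall_abs_shift_sub_le_linear hk hshift hε
  refine ⟨Real.exp T, Real.exp_pos T, fun x hx y hy => ?_⟩
  have hx0 : 0 < x := (Real.exp_pos T).trans_le hx
  have hy0 : 0 < y := hx0.trans_le hy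
  have := hT (Real.log x) ((Real.le_log_iff_exp_le hx0).2 hx) (Real.log y - Real.log x)
    (sub_nonneg.2 (Real.log_le_log hx0 hy))
  rw [add_sub_cancel, Real.exp_log hx0, Real.exp_log hy0] at this
  convert this using 2
  ring

lemma tendsto_atTop_of_regularlyVarying {b : ℝ → ℝ} (hb_meas : Measurable b)
    (hb_pos : ∀ y ≥ (0:ℝ), 0 < b y) {β : ℝ} (hβ : 0 < β)
    (hb_rv : ∀ l > (0:ℝ), Tendsto (fun y : ℝ => b (l * y) / b y) atTop (nhds (l ^ β))) :
    Tendsto b atTop atTop := by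
  obtain ⟨X, hX, hP⟩ := potter_bound hb_meas hb_pos hb_rv (half_pos hβ)
  have hlog : Tendsto (fun y => Real.log (b y)) atTop atTop := by
    refine tendsto_atTop_mono' _ ?_ (tendsto_atTop_add_const_right _
      (Real.log (b X) - β / 2 - β / 2 * Real.log X)
      (Real.tendsto_log_atTop.const_mul_atTop (half_pos hβ)))
    filter_upwards [eventually_ge_atTop X] with y hy
    linarith [(abs_le.1 (hP X le_rfl y hy)).1]
  refine (Real.tendsto_exp_atTop.comp hlog).congr' ?_
  filter_upwards [eventually_ge_atTop 0] with y hy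
  exact Real.exp_log (hb_pos y hy)

/-- A regularly varying function is dominated by an affine function of `exp y` which is nearly
tight at `y₀`. -/
lemma eventually_le_affine_exp {b : ℝ → ℝ} (hb_meas : Measurable b)
    (hb_pos : ∀ y ≥ (0:ℝ), 0 < b y)
    (hb_locbdd : ∀ r : ℝ, ∃ C : ℝ, ∀ y ∈ Set.Icc (0:ℝ) r, b y ≤ C) {β : ℝ} (hβ : 0 < β)
    (hb_rv : ∀ l > (0:ℝ), Tendsto (fun y : ℝ => b (l * y) / b y) atTop (nhds (l ^ β)))
    {ε : ℝ} (hε : 0 < ε) {N : ℕ} (hN : 0 < N) :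
    ∀ᶠ y₀ in atTop, ∀ y ≥ 0,
      b y ≤ Real.exp ε * b y₀ + Real.exp ε * b y₀ / N * Real.exp (y - y₀) := by
  set δ := min ε β
  have hδ : 0 < δ := lt_min hε hβ
  have hδε : δ ≤ ε := min_le_left _ _
  have hδβ : δ ≤ β := min_le_right _ _
  obtain ⟨X, hX, hP⟩ := potter_bound hb_meas hb_pos hb_rv hδ
  obtain ⟨C, hC⟩ := hb_locbdd X
  filter_upwards [eventually_ge_atTop X, eventually_ge_atTop ((β + δ) * N),
    (tendsto_atTop_of_regularlyVarying hb_meas hb_pos hβ hb_rv).eventually_ge_atTop C]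
    with y₀ hXy hNy hCy y hy
  have hy₀ : 0 < y₀ := hX.trans_le hXy
  have hb₀ : 0 < b y₀ := hb_pos y₀ hy₀.le
  have hN' : (0 : ℝ) < N := by exact_mod_cast hN
  have hnonneg : 0 ≤ Real.exp ε * b y₀ / N * Real.exp (y - y₀) := by positivity
  have hexp : 1 ≤ Real.exp ε := Real.one_le_exp hε.le
  rcases le_total y X with hyX | hyX
  · nlinarith [hC y ⟨hy, hyX⟩]
  have hy0 : 0 < y := hX.trans_le hyX
  rcases le_total y y₀ with hyy | hyy
  · have hb := (abs_le.1 (hP y hyX y₀ hyy)).1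
    have hl : 0 ≤ Real.log y₀ - Real.log y := sub_nonneg.2 (Real.log_le_log hy0 hyy)
    have hle : Real.log (b y) ≤ ε + Real.log (b y₀) := by nlinarith
    rw [Real.log_le_iff_le_exp (hb_pos y hy), Real.exp_add, Real.exp_log hb₀] at hle
    linarith
  · have hb := (abs_le.1 (hP y₀ hXy y hyy)).2
    set w := (β + δ) * (y / y₀ - 1)
    have hr : 1 ≤ y / y₀ := (one_le_div hy₀).2 hyy
    have hl : Real.log y - Real.log y₀ ≤ y / y₀ - 1 := by
      rw [← Real.log_div hy0.ne' hy₀.ne']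
      exact Real.log_le_sub_one_of_pos (by positivity)
    have hw : (β + δ) * (Real.log y - Real.log y₀) ≤ w :=
      mul_le_mul_of_nonneg_left hl (by positivity)
    have hle : Real.log (b y) ≤ ε + Real.log (b y₀) + w := by nlinarith
    rw [Real.log_le_iff_le_exp (hb_pos y hy), Real.exp_add, Real.exp_add, Real.exp_log hb₀] at hle
    have hNw : N * w ≤ y - y₀ := by
      calc N * w = (β + δ) * N * (y / y₀ - 1) := by ring
        _ ≤ y₀ * (y / y₀ - 1) := mul_le_mul_of_nonneg_right hNy (by linarith)
        _ = y - y₀ := by field_simp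
    have hbern : 1 + N * (Real.exp w - 1) ≤ Real.exp (y - y₀) := by
      have := one_add_mul_le_pow (a := Real.exp w - 1) (by linarith [Real.exp_pos w]) N
      rw [add_sub_cancel, ← Real.exp_nat_mul] at this
      exact this.trans (Real.exp_le_exp.2 hNw)
    have hz : Real.exp w ≤ 1 + Real.exp (y - y₀) / N := by
      rw [← sub_le_iff_le_add', le_div_iff₀ hN']
      linarith
    calc b y ≤ Real.exp ε * b y₀ * Real.exp w := hle
      _ ≤ Real.exp ε * b y₀ * (1 + Real.exp (y - y₀) / N) := by gcongr
      _ = _ := by ring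

/-- The pointwise infimum of the affine functions `x ↦ p.1 + p.2 * x`, `p ∈ S`. When these are the
nondecreasing affine majorants of a function, this is its least nondecreasing concave majorant. -/
noncomputable def affineInf (S : Set (ℝ × ℝ)) (x : ℝ) : ℝ :=
  ⨅ p : S, (p.1.1 + p.1.2 * x)

section AffineInf

variable {S : Set (ℝ × ℝ)}

lemma affineInf_le (hS : ∀ p ∈ S, 0 ≤ p.1 ∧ 0 ≤ p.2) {x : ℝ} (hx : 0 ≤ x)
    {p : ℝ × ℝ} (hp : p ∈ S) : affineInf S x ≤ p.1 + p.2 * x := by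
  refine ciInf_le (f := fun q : S => q.1.1 + q.1.2 * x) ⟨0, ?_⟩ ⟨p, hp⟩
  rintro _ ⟨q, rfl⟩
  have := hS q q.2
  exact add_nonneg this.1 (mul_nonneg this.2 hx)

lemma le_affineInf (hne : S.Nonempty) {x c : ℝ} (h : ∀ p ∈ S, c ≤ p.1 + p.2 * x) :
    c ≤ affineInf S x :=
  have := hne.to_subtype
  le_ciInf fun p : S => h p p.2

lemma monotoneOn_affineInf (hne : S.Nonempty) (hS : ∀ p ∈ S, 0 ≤ p.1 ∧ 0 ≤ p.2) :
    MonotoneOn (affineInf S) (Ici 0) := fun _ hx _ _ hxy =>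
  le_affineInf hne fun _ hp => (affineInf_le hS hx hp).trans
    (add_le_add_right (mul_le_mul_of_nonneg_left hxy (hS _ hp).2) _)

lemma concaveOn_affineInf (hne : S.Nonempty) (hS : ∀ p ∈ S, 0 ≤ p.1 ∧ 0 ≤ p.2) :
    ConcaveOn ℝ (Ici 0) (affineInf S) := by
  refine ⟨convex_Ici 0, fun x hx y hy a c ha hc hac => le_affineInf hne fun p hp => ?_⟩
  have h1 := mul_le_mul_of_nonneg_left (affineInf_le hS hx hp) ha
  have h2 := mul_le_mul_of_nonneg_left (affineInf_le hS hy hp) hc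
  simp only [smul_eq_mul]
  calc _ ≤ a * (p.1 + p.2 * x) + c * (p.1 + p.2 * y) := add_le_add h1 h2
    _ = (a + c) * p.1 + p.2 * (a * x + c * y) := by ring
    _ = _ := by rw [hac, one_mul]

end AffineInf

/-- For `b` regularly varying with exponent `β > 0` there is a nondecreasing concave
function `f̃ : [0,∞) → [0,∞)` with `f̃(0) = 0`, `f̃(x) → ∞`, and `f̃(x) ~ b(log x)`
as `x → ∞`. -/
theorem stmt10
    (b : ℝ → ℝ) (hb_meas : Measurable b) (hb_pos : ∀ y ≥ (0:ℝ), 0 < b y)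
    (hb_locbdd : ∀ r : ℝ, ∃ C : ℝ, ∀ y ∈ Set.Icc (0:ℝ) r, b y ≤ C)
    (β : ℝ) (hβ : 0 < β)
    (hb_rv : ∀ l > (0:ℝ), Tendsto (fun y : ℝ => b (l * y) / b y) atTop (nhds (l ^ β))) :
    ∃ f : ℝ → ℝ,
      (∀ x ≥ (0:ℝ), 0 ≤ f x) ∧
      MonotoneOn f (Set.Ici (0:ℝ)) ∧
      ConcaveOn ℝ (Set.Ici (0:ℝ)) f ∧
      f 0 = 0 ∧
      Tendsto f atTop atTop ∧
      Tendsto (fun x : ℝ => f x / b (Real.log x)) atTop (nhds 1) := by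
  let S : Set (ℝ × ℝ) :=
    {p | (0 ≤ p.1 ∧ 0 ≤ p.2) ∧ ∀ y ≥ 0, b y ≤ p.1 + p.2 * Real.exp y}
  have hS : ∀ p ∈ S, 0 ≤ p.1 ∧ 0 ≤ p.2 := fun p hp => hp.1
  have hmaj : ∀ ε > 0, ∀ N : ℕ, 0 < N → ∀ᶠ y₀ in atTop,
      (Real.exp ε * b y₀, Real.exp ε * b y₀ / N * Real.exp (-y₀)) ∈ S := by
    intro ε hε N hN
    filter_upwards [eventually_ge_atTop 0,
      eventually_le_affine_exp hb_meas hb_pos hb_locbdd hβ hb_rv hε hN] with y₀ hy₀ h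
    have := hb_pos y₀ hy₀
    refine ⟨⟨by positivity, by positivity⟩, fun y hy => (h y hy).trans_eq ?_⟩
    simp only
    rw [mul_assoc _ (Real.exp (-y₀)), ← Real.exp_add, neg_add_eq_sub]
  obtain ⟨M, hM⟩ : ∃ M, ((0 : ℝ), M) ∈ S := by
    obtain ⟨y₀, hp, hle⟩ := (hmaj 1 one_pos 1 one_pos).exists
    refine ⟨_, ⟨le_rfl, add_nonneg hp.1 hp.2⟩, fun y hy => (hle y hy).trans ?_⟩
    have := mul_le_mul_of_nonneg_left (Real.one_le_exp hy) hp.1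
    simp only at this ⊢
    linarith
  have hne : S.Nonempty := ⟨_, hM⟩
  have hnonneg : ∀ x ≥ (0:ℝ), 0 ≤ affineInf S x := fun x hx =>
    le_affineInf hne fun p hp => add_nonneg hp.1.1 (mul_nonneg hp.1.2 hx)
  have hlower : ∀ x ≥ (1:ℝ), b (Real.log x) ≤ affineInf S x := fun x hx =>
    le_affineInf hne fun p hp => by
      simpa [Real.exp_log (one_pos.trans_le hx)] using hp.2 _ (Real.log_nonneg hx)
  have hupper : ∀ ε > 0, ∀ᶠ x in atTop,
      affineInf S x ≤ Real.exp ε * (1 + ε) * b (Real.log x) := by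
    intro ε hε
    obtain ⟨N, hN⟩ := exists_nat_one_div_lt hε
    filter_upwards [Real.tendsto_log_atTop.eventually (hmaj ε hε (N + 1) N.succ_pos),
      eventually_ge_atTop 1] with x hx hx1
    have hx0 : 0 < x := one_pos.trans_le hx1
    have hb := hb_pos _ (Real.log_nonneg hx1)
    refine (affineInf_le hS hx0.le hx).trans ?_
    simp only
    rw [Real.exp_neg, Real.exp_log hx0, inv_mul_cancel_right₀ hx0.ne']
    push_cast
    calc _ = Real.exp ε * b (Real.log x) * (1 + 1 / ((N : ℝ) + 1)) := by ring
      _ ≤ Real.exp ε * b (Real.log x) * (1 + ε) := by gcongr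
      _ = _ := by ring
  refine ⟨affineInf S, hnonneg, monotoneOn_affineInf hne hS,
    concaveOn_affineInf hne hS, ?_, ?_, ?_⟩
  · refine le_antisymm ?_ (hnonneg 0 le_rfl)
    simpa using affineInf_le hS le_rfl hM
  · refine tendsto_atTop_mono' _ ?_
      ((tendsto_atTop_of_regularlyVarying hb_meas hb_pos hβ hb_rv).comp Real.tendsto_log_atTop)
    filter_upwards [eventually_ge_atTop 1] with x hx using hlower x hx
  · refine tendsto_order.2 ⟨fun c hc => ?_, fun c hc => ?_⟩
    · filter_upwards [eventually_ge_atTop 1] with x hx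
      exact hc.trans_le ((one_le_div (hb_pos _ (Real.log_nonneg hx))).2 (hlower x hx))
    · have hcont : Tendsto (fun ε : ℝ => Real.exp ε * (1 + ε)) (nhdsWithin 0 (Ioi 0)) (nhds 1) := by
        have : Continuous fun ε : ℝ => Real.exp ε * (1 + ε) := by fun_prop
        simpa using (this.tendsto 0).mono_left nhdsWithin_le_nhds
      obtain ⟨ε, hεc, hε⟩ := ((hcont.eventually (gt_mem_nhds hc)).and self_mem_nhdsWithin).exists
      filter_upwards [hupper ε hε, eventually_ge_atTop 1] with x hx hx1
      exact ((div_le_iff₀ (hb_pos _ (Real.log_nonneg hx1))).2 hx).trans_lt hεc
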